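/- Let S be an antipodal point set of 8 points on the unit circle with clockwise order p₁, p₂, p₃, p₄, p₁', p₂', p₃', p₄' (where pᵢ' = -pᵢ). Then the non-thin antipodal quadrilateral with vertices p₁, p₂, p₄, p₃' has strictly larger area than each of the four thin antipodal quadrilaterals on S. -/

import Mathlib

open MeasureTheory

/-- The point on the unit circle at angle `θ`. -/
noncomputable def pt (θ : ℝ) : ℝ × ℝ := (Real.cos θ, Real.sin θ)

/-- Standard dot product in the plane. -/
noncomputable def dotp (v w : ℝ × ℝ) : ℝ := v.1 * w.1 + v.2 * w.2

/-- Given angles `θ : Fin n → ℝ` (determining the antipodal point set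
`{pt (θ i)} ∪ {-pt (θ i)}`) and a selection `ε`, the `i`-th vertex of the
corresponding antipodal polygon: `pt (θ i)` if `ε i` and `-pt (θ i)` otherwise. -/
noncomputable def vtx {n : ℕ} (θ : Fin n → ℝ) (ε : Fin n → Bool) (i : Fin n) : ℝ × ℝ :=
  if ε i then pt (θ i) else -pt (θ i)

/-- The antipodal polygon determined by the selection `ε`. -/
noncomputable def apoly {n : ℕ} (θ : Fin n → ℝ) (ε : Fin n → Bool) : Set (ℝ × ℝ) :=
  convexHull ℝ (Set.range (vtx θ ε))

/-- The antipodal polygon is thin: all vertices lie in a closed half-plane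
bounded by a line through the origin. -/
def Thin {n : ℕ} (θ : Fin n → ℝ) (ε : Fin n → Bool) : Prop :=
  ∃ v : ℝ × ℝ, v ≠ 0 ∧ ∀ i, 0 ≤ dotp v (vtx θ ε i)

/-- The antipodal polygon is thick: every open half-plane bounded by a line
through the origin contains at least `⌈(n-2)/2⌉ = (n-1)/2` of its vertices. -/
def Thick {n : ℕ} (θ : Fin n → ℝ) (ε : Fin n → Bool) : Prop :=
  ∀ v : ℝ × ℝ, v ≠ 0 →
    (n - 1) / 2 ≤ Set.ncard {i : Fin n | 0 < dotp v (vtx θ ε i)}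

/-- The `j`-th point (indices mod `2*n`) of the antipodal point set in circular
order `pt (θ 0), …, pt (θ (n-1)), -pt (θ 0), …, -pt (θ (n-1))`. -/
noncomputable def spt {n : ℕ} (θ : Fin n → ℝ) (j : ℕ) : ℝ × ℝ :=
  if h : j % (2 * n) < n then pt (θ ⟨j % (2 * n), h⟩)
  else if h2 : j % (2 * n) - n < n then -pt (θ ⟨j % (2 * n) - n, h2⟩) else 0

/-- Whether the `j`-th point (indices mod `2*n`) of the antipodal point set, in the
circular order `pt (θ 0), …, pt (θ (n-1)), -pt (θ 0), …, -pt (θ (n-1))`,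
is a vertex of the antipodal polygon selected by `ε`. -/
def chosen {n : ℕ} (ε : Fin n → Bool) (j : ℕ) : Bool :=
  if h : j % (2 * n) < n then ε ⟨j % (2 * n), h⟩
  else if h2 : j % (2 * n) - n < n then !(ε ⟨j % (2 * n) - n, h2⟩) else false

/-- Twice the signed area of the triangle `A B C`. -/
noncomputable def orient (A B C : ℝ × ℝ) : ℝ :=
  (B.1 - A.1) * (C.2 - A.2) - (B.2 - A.2) * (C.1 - A.1)

/-- The standard triangle in the plane. -/
def stdTriangle : Set (ℝ × ℝ) := convexHull ℝ {(0, 0), (1, 0), (0, 1)}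

lemma mem_convexHull_triple {A B C p : ℝ × ℝ} :
    p ∈ convexHull ℝ {A, B, C} ↔
      ∃ a b c : ℝ, 0 ≤ a ∧ 0 ≤ b ∧ 0 ≤ c ∧ a + b + c = 1 ∧ a • A + b • B + c • C = p := by
  constructor
  · intro h
    rw [convexHull_insert (by simp), mem_convexJoin] at h
    obtain ⟨x, hx, y, hy, hp⟩ := h
    rw [Set.mem_singleton_iff] at hx
    subst hx
    rw [convexHull_pair] at hy
    obtain ⟨s, t, hs, ht, hst, rfl⟩ := hy
    obtain ⟨u, v, hu, hv, huv, rfl⟩ := hp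
    refine ⟨u, v * s, v * t, hu, by positivity, by positivity, ?_, ?_⟩
    · rw [add_assoc, ← mul_add, hst, mul_one, huv]
    · rw [smul_add, smul_smul, smul_smul, add_assoc]
  · rintro ⟨a, b, c, ha, hb, hc, h, rfl⟩
    have hA : A ∈ convexHull ℝ {A, B, C} := subset_convexHull ℝ _ (by simp)
    have hB : B ∈ convexHull ℝ {A, B, C} := subset_convexHull ℝ _ (by simp)
    have hC : C ∈ convexHull ℝ {A, B, C} := subset_convexHull ℝ _ (by simp)
    have := (convex_convexHull ℝ {A, B, C}).sum_mem (t := Finset.univ) (w := ![a, b, c])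
      (z := ![A, B, C]) (by simp [Fin.forall_fin_succ, ha, hb, hc])
      (by simpa [Fin.sum_univ_succ, add_assoc] using h)
      (by simp [Fin.forall_fin_succ, hA, hB, hC])
    simpa [Fin.sum_univ_succ, add_assoc] using this

lemma isCompact_convexHull_triple (A B C : ℝ × ℝ) : IsCompact (convexHull ℝ {A, B, C}) :=
  (Set.toFinite _).isCompact_convexHull ℝ

lemma volume_stdTriangle_ne_top : volume stdTriangle ≠ ⊤ :=
  (isCompact_convexHull_triple _ _ _).measure_ne_top

lemma volume_stdTriangle_ne_zero : volume stdTriangle ≠ 0 := by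
  have hopen : IsOpen {p : ℝ × ℝ | 0 < p.1 ∧ 0 < p.2 ∧ p.1 + p.2 < 1} := by
    simp only [Set.ofPred_and]
    refine IsOpen.inter ?_ (IsOpen.inter ?_ ?_) <;> exact isOpen_lt (by fun_prop) (by fun_prop)
  refine ((hopen.measure_pos volume ⟨(1 / 4, 1 / 4), by norm_num⟩).trans_le
    (measure_mono ?_)).ne'
  rintro ⟨x, y⟩ ⟨hx, hy, hxy⟩
  exact mem_convexHull_triple.2
    ⟨1 - x - y, x, y, by simp at hxy; linarith, hx.le, hy.le, by ring, by simp⟩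

lemma volume_triangle (A B C : ℝ × ℝ) :
    volume (convexHull ℝ {A, B, C}) = ENNReal.ofReal |orient A B C| * volume stdTriangle := by
  set f : ℝ × ℝ →ₗ[ℝ] ℝ × ℝ := Matrix.toLin (Module.Basis.finTwoProd ℝ) (Module.Basis.finTwoProd ℝ)
    !![B.1 - A.1, C.1 - A.1; B.2 - A.2, C.2 - A.2] with hf
  have hdet : LinearMap.det f = orient A B C := by
    rw [hf, LinearMap.det_toLin, Matrix.det_fin_two_of, orient]
    ring
  have himg : convexHull ℝ {A, B, C} = (fun p => A + p) '' (f '' stdTriangle) := by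
    ext p
    simp only [Set.mem_image, stdTriangle, mem_convexHull_triple]
    constructor
    · rintro ⟨a, b, c, ha, hb, hc, h, rfl⟩
      refine ⟨_, ⟨_, ⟨a, b, c, ha, hb, hc, h, rfl⟩, rfl⟩, ?_⟩
      obtain rfl : a = 1 - b - c := by linarith
      ext <;> simp [hf, Matrix.toLin_finTwoProd_apply] <;> ring
    · rintro ⟨_, ⟨_, ⟨a, b, c, ha, hb, hc, h, rfl⟩, rfl⟩, rfl⟩
      refine ⟨a, b, c, ha, hb, hc, h, ?_⟩
      obtain rfl : a = 1 - b - c := by linarith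
      ext <;> simp [hf, Matrix.toLin_finTwoProd_apply] <;> ring
  rw [himg, Set.image_add_left, measure_preimage_add, Measure.addHaar_image_linearMap, hdet]

lemma volume_line {u v : ℝ} (w : ℝ) (h : u ≠ 0 ∨ v ≠ 0) :
    volume {p : ℝ × ℝ | u * p.1 + v * p.2 = w} = 0 := by
  let ℓ : ℝ × ℝ →ᵃ[ℝ] ℝ :=
    (u • LinearMap.fst ℝ ℝ ℝ + v • LinearMap.snd ℝ ℝ ℝ).toAffineMap - AffineMap.const ℝ _ w
  have hℓ : ∀ p, ℓ p = u * p.1 + v * p.2 - w := fun p => by simp [ℓ]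
  let E : AffineSubspace ℝ (ℝ × ℝ) := (AffineSubspace.mk' (0 : ℝ) ⊥).comap ℓ
  have hE : (E : Set (ℝ × ℝ)) = {p : ℝ × ℝ | u * p.1 + v * p.2 = w} := by
    ext p
    simp [E, AffineSubspace.mem_mk', hℓ, sub_eq_zero]
  rw [← hE]
  refine Measure.addHaar_affineSubspace _ _ fun htop => ?_
  have hall : ∀ p : ℝ × ℝ, u * p.1 + v * p.2 = w := fun p => by
    have : p ∈ (E : Set (ℝ × ℝ)) := by rw [htop]; trivial
    rwa [hE] at this
  have h0 := hall (0, 0)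
  have h1 := hall (1, 0)
  have h2 := hall (0, 1)
  simp at h0 h1 h2
  grind

lemma convexHull_quad_subset {A B C D : ℝ × ℝ} (hABC : 0 < orient A B C) (hACD : 0 < orient A C D)
    (hABD : 0 < orient A B D) (hBCD : 0 < orient B C D) :
    convexHull ℝ {A, B, C, D} ⊆ convexHull ℝ {A, B, C} ∪ convexHull ℝ {A, C, D} := by
  intro p hp
  rw [convexHull_insert (by simp), mem_convexJoin] at hp
  obtain ⟨x, hx, y, hy, hp⟩ := hp
  rw [Set.mem_singleton_iff] at hx
  subst hx
  obtain ⟨b, c, d, hb, hc, hd, hsum, rfl⟩ := mem_convexHull_triple.1 hy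
  obtain ⟨u, v, hu, hv, huv, rfl⟩ := hp
  obtain rfl : u = 1 - v := by linarith
  obtain rfl : b = 1 - c - d := by linarith
  simp only [Set.mem_union, mem_convexHull_triple]
  have hrel : orient x B C + orient x C D = orient x B D + orient B C D := by
    simp only [orient]; ring
  rcases le_total (v * (1 - c - d) * orient x B C) (v * d * orient x C D) with h | h
  · right
    set t := v * (1 - c - d) / orient x C D with ht
    have htm : t * orient x C D = v * (1 - c - d) := by rw [ht]; field_simp
    have ht0 : 0 ≤ t := by positivity
    refine ⟨1 - v + t * orient B C D, v * c + t * orient x B D, v * d - t * orient x B C,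
      by positivity, by positivity, ?_, ?_, ?_⟩
    · rw [← htm] at h
      have : 0 ≤ orient x C D * (v * d - t * orient x B C) := by linarith
      exact nonneg_of_mul_nonneg_right this hACD
    · linear_combination htm - t * hrel
    · ext <;> simp <;> simp only [orient] at htm ⊢
      · linear_combination htm * B.1
      · linear_combination htm * B.2
  · left
    set t := v * d / orient x B C with ht
    have htm : t * orient x B C = v * d := by rw [ht]; field_simp
    have ht0 : 0 ≤ t := by positivity
    refine ⟨1 - v + t * orient B C D, v * (1 - c - d) - t * orient x C D, v * c + t * orient x B D,
      by positivity, ?_, by positivity, ?_, ?_⟩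
    · rw [← htm] at h
      have : 0 ≤ orient x B C * (v * (1 - c - d) - t * orient x C D) := by linarith
      exact nonneg_of_mul_nonneg_right this hABC
    · linear_combination htm - t * hrel
    · ext <;> simp <;> simp only [orient] at htm ⊢
      · linear_combination htm * D.1
      · linear_combination htm * D.2

lemma volume_quad {A B C D : ℝ × ℝ} (hABC : 0 < orient A B C) (hACD : 0 < orient A C D)
    (hABD : 0 < orient A B D) (hBCD : 0 < orient B C D) :
    volume (convexHull ℝ {A, B, C, D}) =
      ENNReal.ofReal (orient A B C + orient A C D) * volume stdTriangle := by
  have hset : convexHull ℝ {A, B, C, D} = convexHull ℝ {A, B, C} ∪ convexHull ℝ {A, C, D} :=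
    (convexHull_quad_subset hABC hACD hABD hBCD).antisymm <| Set.union_subset
      (convexHull_mono (by grind)) (convexHull_mono (by grind))
  have hdisj : AEDisjoint volume (convexHull ℝ {A, B, C}) (convexHull ℝ {A, C, D}) := by
    have hne : A.2 - C.2 ≠ 0 ∨ C.1 - A.1 ≠ 0 := by
      by_contra! h
      simp only [orient] at hACD
      rw [h.2, show C.2 - A.2 = 0 by linarith [h.1]] at hACD
      simp at hACD
    refine measure_mono_null ?_
      (volume_line ((A.2 - C.2) * A.1 + (C.1 - A.1) * A.2) hne)
    rintro p ⟨h1, h2⟩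
    obtain ⟨a, b, c, ha, hb, hc, h, rfl⟩ := mem_convexHull_triple.1 h1
    obtain ⟨a', c', d', ha', hc', hd', h', heq⟩ := mem_convexHull_triple.1 h2
    obtain rfl : a = 1 - b - c := by linarith
    obtain rfl : a' = 1 - c' - d' := by linarith
    have e1 := congrArg Prod.fst heq
    have e2 := congrArg Prod.snd heq
    have hb' := mul_nonneg hb hABC.le
    have hd'' := mul_nonneg hd' hACD.le
    simp [orient] at e1 e2 hb' hd'' ⊢
    apply le_antisymm
    · linarith
    · linear_combination hd'' + (A.2 - C.2) * e1 + (C.1 - A.1) * e2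
  rw [hset, measure_union₀ (isCompact_convexHull_triple _ _ _).measurableSet.nullMeasurableSet
    hdisj, volume_triangle, volume_triangle, abs_of_pos hABC, abs_of_pos hACD,
    ENNReal.ofReal_add hABC.le hACD.le, add_mul]

lemma orient_pt (x y z : ℝ) :
    orient (pt x) (pt y) (pt z) = Real.sin (y - x) + Real.sin (z - y) - Real.sin (z - x) := by
  simp only [orient, pt, Real.sin_sub]
  ring

lemma orient_pt_pos {x y z : ℝ} (hxy : x < y) (hyz : y < z) (hzx : z < x + 2 * Real.pi) :
    0 < orient (pt x) (pt y) (pt z) := by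
  have h1 : 0 < Real.sin ((y - x) / 2) := Real.sin_pos_of_pos_of_lt_pi (by linarith) (by linarith)
  have h2 : 0 < Real.sin ((z - y) / 2) := Real.sin_pos_of_pos_of_lt_pi (by linarith) (by linarith)
  have h3 : 0 < Real.sin ((z - x) / 2) := Real.sin_pos_of_pos_of_lt_pi (by linarith) (by linarith)
  have key : orient (pt x) (pt y) (pt z) =
      4 * (Real.sin ((y - x) / 2) * Real.sin ((z - y) / 2) * Real.sin ((z - x) / 2)) := by
    rw [orient_pt, show y - x = 2 * ((y - x) / 2) by ring, show z - y = 2 * ((z - y) / 2) by ring,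
      show z - x = 2 * ((y - x) / 2 + (z - y) / 2) by ring]
    generalize (y - x) / 2 = u
    generalize (z - y) / 2 = v
    rw [show 2 * u / 2 = u by ring, show 2 * v / 2 = v by ring,
      show 2 * (u + v) / 2 = u + v by ring]
    simp only [Real.sin_two_mul, Real.sin_add, Real.cos_add]
    have hu := Real.sin_sq_add_cos_sq u
    have hv := Real.sin_sq_add_cos_sq v
    linear_combination (-2 * Real.sin v * Real.cos v) * hu - 2 * Real.sin u * Real.cos u * hv
  rw [key]
  positivity

lemma volume_cyclic_quad {x y z w : ℝ} (hxy : x < y) (hyz : y < z) (hzw : z < w)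
    (hwx : w < x + 2 * Real.pi) :
    volume (convexHull ℝ {pt x, pt y, pt z, pt w}) =
      ENNReal.ofReal (Real.sin (y - x) + Real.sin (z - y) + Real.sin (w - z) - Real.sin (w - x)) *
        volume stdTriangle := by
  rw [volume_quad (orient_pt_pos hxy hyz (by linarith)) (orient_pt_pos (by linarith) hzw hwx)
    (orient_pt_pos hxy (by linarith) hwx) (orient_pt_pos hyz hzw (by linarith)),
    orient_pt, orient_pt]
  congr 2
  ring

lemma volume_cyclic_quad_lt {x y z w x' y' z' w' : ℝ} (hxy : x < y) (hyz : y < z) (hzw : z < w)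
    (hwx : w < x + 2 * Real.pi) (hxy' : x' < y') (hyz' : y' < z') (hzw' : z' < w')
    (hwx' : w' < x' + 2 * Real.pi)
    (h : Real.sin (y - x) + Real.sin (z - y) + Real.sin (w - z) - Real.sin (w - x) <
      Real.sin (y' - x') + Real.sin (z' - y') + Real.sin (w' - z') - Real.sin (w' - x')) :
    volume (convexHull ℝ {pt x, pt y, pt z, pt w}) <
      volume (convexHull ℝ {pt x', pt y', pt z', pt w'}) := by
  rw [volume_cyclic_quad hxy hyz hzw hwx, volume_cyclic_quad hxy' hyz' hzw' hwx']
  have hpos : 0 < Real.sin (y - x) + Real.sin (z - y) + Real.sin (w - z) - Real.sin (w - x) := by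
    have h1 := orient_pt_pos hxy hyz (by linarith)
    have h2 := orient_pt_pos (hxy.trans hyz) hzw hwx
    rw [orient_pt] at h1 h2
    linarith
  exact ENNReal.mul_lt_mul_left volume_stdTriangle_ne_zero volume_stdTriangle_ne_top
    ((ENNReal.ofReal_lt_ofReal_iff (hpos.trans h)).2 h)

lemma sin_lt_sin_add_sin_add_sin {α β γ : ℝ} (hα : 0 < α) (hβ : 0 < β) (hγ : 0 < γ)
    (h : α + β + γ < Real.pi) :
    Real.sin β < Real.sin (α + β) + Real.sin (β + γ) + Real.sin (α + β + γ) := by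
  have h1 : 0 < Real.sin (β + (α + γ) / 2) :=
    Real.sin_pos_of_pos_of_lt_pi (by linarith) (by linarith)
  have h2 : 0 < Real.sin (α / 2) := Real.sin_pos_of_pos_of_lt_pi (by linarith) (by linarith)
  have h3 : 0 < Real.sin (γ / 2) := Real.sin_pos_of_pos_of_lt_pi (by linarith) (by linarith)
  have h4 : 0 < Real.sin (α + β + γ) := Real.sin_pos_of_pos_of_lt_pi (by linarith) (by linarith)
  have e1 : Real.sin (α + β) + Real.sin (β + γ) =
      2 * Real.sin (β + (α + γ) / 2) * Real.cos ((α - γ) / 2) := by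
    rw [show α + β = (β + (α + γ) / 2) + (α - γ) / 2 by ring,
      show β + γ = (β + (α + γ) / 2) - (α - γ) / 2 by ring, Real.sin_add, Real.sin_sub]
    ring
  have e2 : Real.sin (α + β + γ) - Real.sin β =
      2 * Real.cos (β + (α + γ) / 2) * Real.sin ((α + γ) / 2) := by
    rw [show α + β + γ = (β + (α + γ) / 2) + (α + γ) / 2 by ring,
      show Real.sin β = Real.sin ((β + (α + γ) / 2) - (α + γ) / 2) by ring_nf,
      Real.sin_add, Real.sin_sub]
    ring
  have e3 : Real.cos ((α - γ) / 2) =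
      Real.cos ((α + γ) / 2) + 2 * (Real.sin (α / 2) * Real.sin (γ / 2)) := by
    rw [show (α - γ) / 2 = α / 2 - γ / 2 by ring, show (α + γ) / 2 = α / 2 + γ / 2 by ring,
      Real.cos_add, Real.cos_sub]
    ring
  have e4 : Real.sin (α + β + γ) = Real.sin (β + (α + γ) / 2) * Real.cos ((α + γ) / 2) +
      Real.cos (β + (α + γ) / 2) * Real.sin ((α + γ) / 2) := by
    rw [← Real.sin_add]
    ring_nf
  have h5 : 0 < Real.sin (β + (α + γ) / 2) * (Real.sin (α / 2) * Real.sin (γ / 2)) := by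
    positivity
  rw [e3] at e1
  linarith

lemma sin_add_sin_lt {α β δ : ℝ} (hα : 0 < α) (hβ : 0 < β) (hδ : 0 < δ)
    (h : α + β + δ < Real.pi) :
    Real.sin β + Real.sin δ < 2 * Real.sin α + Real.sin (α + δ) + Real.sin (α + β) := by
  have h1 : 0 < Real.sin α := Real.sin_pos_of_pos_of_lt_pi (by linarith) (by linarith)
  have h2 : 0 < Real.sin (α / 2) := Real.sin_pos_of_pos_of_lt_pi (by linarith) (by linarith)
  have h3 : 0 < Real.cos ((α + β + δ) / 2) :=
    Real.cos_pos_of_mem_Ioo ⟨by linarith, by linarith⟩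
  have h4 : 0 < Real.cos ((β - δ) / 2) :=
    Real.cos_pos_of_mem_Ioo ⟨by linarith, by linarith⟩
  have e1 : ∀ t, Real.sin (α + t) - Real.sin t = 2 * Real.sin (α / 2) * Real.cos (t + α / 2) := by
    intro t
    rw [Real.sin_sub_sin]
    ring_nf
  have e2 : Real.cos (β + α / 2) + Real.cos (δ + α / 2) =
      2 * Real.cos ((α + β + δ) / 2) * Real.cos ((β - δ) / 2) := by
    rw [Real.cos_add_cos]
    ring_nf
  have h5 : 0 < Real.sin (α / 2) * (2 * Real.cos ((α + β + δ) / 2) * Real.cos ((β - δ) / 2)) := by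
    positivity
  rw [← e2] at h5
  linarith [e1 β, e1 δ]

lemma pt_add_pi (x : ℝ) : pt (x + Real.pi) = -pt x := by simp [pt]

lemma pt_sub_pi (x : ℝ) : pt (x - Real.pi) = -pt x := by simp [pt]

/-- A vector cannot be weakly positive against `pt x`, `-pt y` and `pt z` when these three points
surround the origin. -/
lemma eq_zero_of_alternating {v : ℝ × ℝ} {x y z : ℝ} (hxy : x < y) (hyz : y < z)
    (hzx : z < x + Real.pi) (hx : 0 ≤ dotp v (pt x)) (hy : dotp v (pt y) ≤ 0)
    (hz : 0 ≤ dotp v (pt z)) : v = 0 := by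
  have h1 : 0 < Real.sin (y - x) := Real.sin_pos_of_pos_of_lt_pi (by linarith) (by linarith)
  have h2 : 0 < Real.sin (z - y) := Real.sin_pos_of_pos_of_lt_pi (by linarith) (by linarith)
  have h3 : 0 < Real.sin (z - x) := Real.sin_pos_of_pos_of_lt_pi (by linarith) (by linarith)
  have hrel : Real.sin (z - y) * dotp v (pt x) + Real.sin (z - x) * -dotp v (pt y) +
      Real.sin (y - x) * dotp v (pt z) = 0 := by
    simp only [dotp, pt, Real.sin_sub]
    ring
  have p1 := mul_nonneg h2.le hx
  have p2 := mul_nonneg h3.le (neg_nonneg.2 hy)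
  have p3 := mul_nonneg h1.le hz
  have hx0 : dotp v (pt x) = 0 :=
    (mul_eq_zero.1 (by linarith : Real.sin (z - y) * dotp v (pt x) = 0)).resolve_left h2.ne'
  have hz0 : dotp v (pt z) = 0 :=
    (mul_eq_zero.1 (by linarith : Real.sin (y - x) * dotp v (pt z) = 0)).resolve_left h1.ne'
  have c1 : Real.sin (z - x) * v.1 = 0 := by
    have : Real.sin (z - x) * v.1 =
        Real.sin z * dotp v (pt x) - Real.sin x * dotp v (pt z) := by
      simp only [dotp, pt, Real.sin_sub]; ring
    rw [this, hx0, hz0]; ring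
  have c2 : Real.sin (z - x) * v.2 = 0 := by
    have : Real.sin (z - x) * v.2 =
        Real.cos x * dotp v (pt z) - Real.cos z * dotp v (pt x) := by
      simp only [dotp, pt, Real.sin_sub]; ring
    rw [this, hx0, hz0]; ring
  ext
  · exact (mul_eq_zero.1 c1).resolve_left h3.ne'
  · exact (mul_eq_zero.1 c2).resolve_left h3.ne'

/-- The selection of a thin antipodal polygon does not alternate along three increasing angles. -/
lemma Thin.not_alternating {n : ℕ} {θ : Fin n → ℝ} (hmono : StrictMono θ)
    (hrange : ∀ i, θ i ∈ Set.Ico 0 Real.pi) {ε : Fin n → Bool} (hthin : Thin θ ε)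
    {i j k : Fin n} (hij : i < j) (hjk : j < k) : ¬ (ε i = ε k ∧ ε j = !ε i) := by
  rintro ⟨hik, hj⟩
  obtain ⟨v, hv, h⟩ := hthin
  have hki : θ k < θ i + Real.pi := by linarith [(hrange k).2, (hrange i).1]
  have hi := h i
  have hj' := h j
  have hk := h k
  simp only [vtx, hj, ← hik] at hi hj' hk
  have hneg : ∀ p, dotp v (-p) = -dotp v p := fun p => by simp [dotp]; ring
  have hneg' : ∀ p, dotp (-v) p = -dotp v p := fun p => by simp [dotp]; ring
  cases hε : ε i <;> simp [hε, hneg] at hi hj' hk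
  · refine hv (neg_eq_zero.1 (eq_zero_of_alternating (hmono hij) (hmono hjk) hki ?_ ?_ ?_)) <;>
      rw [hneg'] <;> linarith
  · exact hv (eq_zero_of_alternating (hmono hij) (hmono hjk) hki hi hj' hk)

lemma apoly_four (θ : Fin 4 → ℝ) (ε : Fin 4 → Bool) :
    apoly θ ε = convexHull ℝ {vtx θ ε 0, vtx θ ε 1, vtx θ ε 2, vtx θ ε 3} := by
  rw [apoly]
  congr 1
  ext p
  simp [Fin.exists_fin_succ, eq_comm]

/-- For n = 4, the non-thin antipodal quadrilateral with vertices
p₁, p₂, p₄, p₃' has strictly larger area than every thin antipodal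
quadrilateral. -/
theorem stmt_5 (θ : Fin 4 → ℝ) (hmono : StrictMono θ)
    (hrange : ∀ i, θ i ∈ Set.Ico 0 Real.pi)
    (ε : Fin 4 → Bool) (hthin : Thin θ ε) :
    volume (apoly θ ε) < volume (apoly θ ![true, true, false, true]) := by
  have n012 := hthin.not_alternating hmono hrange (i := 0) (j := 1) (k := 2) (by decide) (by decide)
  have n013 := hthin.not_alternating hmono hrange (i := 0) (j := 1) (k := 3) (by decide) (by decide)
  have n023 := hthin.not_alternating hmono hrange (i := 0) (j := 2) (k := 3) (by decide) (by decide)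
  have n123 := hthin.not_alternating hmono hrange (i := 1) (j := 2) (k := 3) (by decide) (by decide)
  have hab : θ 0 < θ 1 := hmono (by decide)
  have hbc : θ 1 < θ 2 := hmono (by decide)
  have hcd : θ 2 < θ 3 := hmono (by decide)
  have hda : θ 3 < θ 0 + Real.pi := by linarith [(hrange 3).2, (hrange 0).1]
  have hpi := Real.pi_pos
  have i1 := sin_lt_sin_add_sin_add_sin (sub_pos.2 hab) (sub_pos.2 hbc) (sub_pos.2 hcd)
    (by linarith)
  have i2 := sin_lt_sin_add_sin_add_sin (sub_pos.2 hab) (sub_pos.2 hda) (sub_pos.2 hcd)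
    (by linarith)
  have i3 := sin_add_sin_lt (sub_pos.2 hab) (sub_pos.2 hbc) (sub_pos.2 hda) (by linarith)
  have i4 := sin_add_sin_lt (sub_pos.2 hcd) (sub_pos.2 hbc) (sub_pos.2 hda) (by linarith)
  have htarget : apoly θ ![true, true, false, true] =
      convexHull ℝ {pt (θ 0), pt (θ 1), pt (θ 3), pt (θ 2 + Real.pi)} := by
    rw [apoly_four, pt_add_pi]
    simp only [vtx]
    congr 1
    ext p
    simp
    tauto
  rw [htarget]
  have reduce : ∀ {x y z w : ℝ}, x < y → y < z → z < w → w < x + 2 * Real.pi →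
      apoly θ ε = convexHull ℝ {pt x, pt y, pt z, pt w} →
      Real.sin (y - x) + Real.sin (z - y) + Real.sin (w - z) - Real.sin (w - x) <
        Real.sin (θ 1 - θ 0) + Real.sin (θ 3 - θ 1) + Real.sin (θ 2 + Real.pi - θ 3) -
          Real.sin (θ 2 + Real.pi - θ 0) →
      volume (apoly θ ε) <
        volume (convexHull ℝ {pt (θ 0), pt (θ 1), pt (θ 3), pt (θ 2 + Real.pi)}) := by
    intro x y z w hxy hyz hzw hwx hset h
    rw [hset]
    exact volume_cyclic_quad_lt hxy hyz hzw hwx hab (by linarith) (by linarith) (by linarith) h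
  have hadd : θ 1 - θ 0 + (θ 0 + Real.pi - θ 3) = θ 1 + Real.pi - θ 3 := by ring
  simp only [hadd, sub_add_sub_cancel', sub_add_sub_cancel, Real.sin_sub, Real.sin_add,
    Real.cos_add, Real.sin_pi, Real.cos_pi] at i1 i2 i3 i4
  cases h0 : ε 0 <;> cases h1 : ε 1 <;> cases h2 : ε 2 <;> cases h3 : ε 3 <;>
    simp [h0, h1, h2, h3] at n012 n013 n023 n123
  · refine reduce (x := θ 0 + Real.pi) (y := θ 1 + Real.pi) (z := θ 2 + Real.pi) (w := θ 3 + Real.pi)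
      (by linarith) (by linarith) (by linarith) (by linarith) ?_ ?_
    · rw [apoly_four]
      congr 1
      ext p
      simp [vtx, h0, h1, h2, h3, pt_add_pi]
      try tauto
    · simp only [Real.sin_sub, Real.sin_add, Real.cos_add, Real.sin_pi, Real.cos_pi]
      linarith
  · refine reduce (x := θ 3) (y := θ 0 + Real.pi) (z := θ 1 + Real.pi) (w := θ 2 + Real.pi)
      (by linarith) (by linarith) (by linarith) (by linarith) ?_ ?_
    · rw [apoly_four]
      congr 1
      ext p
      simp [vtx, h0, h1, h2, h3, pt_add_pi]
      try tauto
    · simp only [Real.sin_sub, Real.sin_add, Real.cos_add, Real.sin_pi, Real.cos_pi]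
      linarith
  · refine reduce (x := θ 2) (y := θ 3) (z := θ 0 + Real.pi) (w := θ 1 + Real.pi)
      (by linarith) (by linarith) (by linarith) (by linarith) ?_ ?_
    · rw [apoly_four]
      congr 1
      ext p
      simp [vtx, h0, h1, h2, h3, pt_add_pi]
      try tauto
    · simp only [Real.sin_sub, Real.sin_add, Real.cos_add, Real.sin_pi, Real.cos_pi]
      linarith
  · refine reduce (x := θ 1) (y := θ 2) (z := θ 3) (w := θ 0 + Real.pi)
      (by linarith) (by linarith) (by linarith) (by linarith) ?_ ?_
    · rw [apoly_four]
      congr 1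
      ext p
      simp [vtx, h0, h1, h2, h3, pt_add_pi]
      try tauto
    · simp only [Real.sin_sub, Real.sin_add, Real.cos_add, Real.sin_pi, Real.cos_pi]
      linarith
  · refine reduce (x := θ 1 - Real.pi) (y := θ 2 - Real.pi) (z := θ 3 - Real.pi) (w := θ 0)
      (by linarith) (by linarith) (by linarith) (by linarith) ?_ ?_
    · rw [apoly_four]
      congr 1
      ext p
      simp [vtx, h0, h1, h2, h3, pt_sub_pi]
      try tauto
    · simp only [Real.sin_sub, Real.sin_add, Real.cos_sub, Real.cos_add, Real.sin_pi, Real.cos_pi]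
      linarith
  · refine reduce (x := θ 2 - Real.pi) (y := θ 3 - Real.pi) (z := θ 0) (w := θ 1)
      (by linarith) (by linarith) (by linarith) (by linarith) ?_ ?_
    · rw [apoly_four]
      congr 1
      ext p
      simp [vtx, h0, h1, h2, h3, pt_sub_pi]
      try tauto
    · simp only [Real.sin_sub, Real.sin_add, Real.cos_sub, Real.cos_add, Real.sin_pi, Real.cos_pi]
      linarith
  · refine reduce (x := θ 3 - Real.pi) (y := θ 0) (z := θ 1) (w := θ 2)
      (by linarith) (by linarith) (by linarith) (by linarith) ?_ ?_
    · rw [apoly_four]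
      congr 1
      ext p
      simp [vtx, h0, h1, h2, h3, pt_sub_pi]
      try tauto
    · simp only [Real.sin_sub, Real.sin_add, Real.cos_sub, Real.cos_add, Real.sin_pi, Real.cos_pi]
      linarith
  · refine reduce (x := θ 0) (y := θ 1) (z := θ 2) (w := θ 3)
      (by linarith) (by linarith) (by linarith) (by linarith) ?_ ?_
    · rw [apoly_four]
      congr 1
      ext p
      simp [vtx, h0, h1, h2, h3]
      try tauto
    · simp only [Real.sin_sub, Real.sin_add, Real.cos_add, Real.sin_pi, Real.cos_pi]
      linarith
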